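/- Let 𝒴, 𝒱 be metric spaces and 𝒴₀, 𝒴₁ ⊆ 𝒴, 𝒱₀, 𝒱₁ ⊆ 𝒱. Let Fₙ : 𝒴₁×𝒱₁ → ℝ∪{∞} be a family of bivariate functionals admitting saddle points (yₙ*, φₙ*) ∈ 𝒴₁×𝒱₁ with supₙ Fₙ(yₙ*, φₙ*) < ∞, and let F∞ : 𝒴₀×𝒱₀ → ℝ. Assume (yₙ*, φₙ*) → (y₀*, φ₀*) ∈ 𝒴₀×𝒱₀ with convergence in 𝒴×𝒱, and that: (i) for every φ̂₀ ∈ 𝒱₀ there exists a sequence (φ̂ₙ) ⊆ 𝒱₁ with φ̂ₙ → φ̂₀ in 𝒱 and liminf_{n→∞} Fₙ(yₙ*, φ̂ₙ) ≥ F∞(y₀*, φ̂₀); (ii) for every ŷ₀ ∈ 𝒴₀ there exists a sequence (ŷₙ) ⊆ 𝒴₁ with ŷₙ → ŷ₀ in 𝒴 and limsup_{n→∞} Fₙ(ŷₙ, φₙ*) ≤ F∞(ŷ₀, φ₀*). Then (y₀*, φ₀*) is a saddle point of F∞ on 𝒴₀×𝒱₀ and lim_{n→∞} Fₙ(yₙ*,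 φₙ*) = F∞(y₀*, φ₀*). -/

import Mathlib

open Filter Topology

/-- **Abstract epi/hypo-convergence of saddle points** (Proposition 4.1).
Let 𝒴, 𝒱 be metric spaces with subsets 𝒴₀, 𝒴₁ and 𝒱₀, 𝒱₁. Given a family of bivariate
functionals Fₙ : 𝒴₁ × 𝒱₁ → ℝ ∪ {∞} (modelled as extended-real-valued and never −∞) with
saddle points (yₙ*, φₙ*) ∈ 𝒴₁ × 𝒱₁ such that supₙ Fₙ(yₙ*, φₙ*) < ∞, converging to
(y₀*, φ₀*) ∈ 𝒴₀ × 𝒱₀, and a limit functional F∞ : 𝒴₀ × 𝒱₀ → ℝ satisfying the liminf and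
limsup conditions (i) and (ii), the limit pair (y₀*, φ₀*) is a saddle point of F∞ on
𝒴₀ × 𝒱₀ and Fₙ(yₙ*, φₙ*) → F∞(y₀*, φ₀*). -/
theorem abstract_saddle_point_convergence
    {Y V : Type*} [MetricSpace Y] [MetricSpace V]
    (Y0 Y1 : Set Y) (V0 V1 : Set V)
    (F : ℕ → Y → V → EReal) (Finf : Y → V → ℝ)
    (hnotbot : ∀ n, ∀ y ∈ Y1, ∀ v ∈ V1, F n y v ≠ ⊥)
    (ystar : ℕ → Y) (vstar : ℕ → V)
    (hymem : ∀ n, ystar n ∈ Y1) (hvmem : ∀ n, vstar n ∈ V1)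
    (hsaddle : ∀ n, ∀ yh ∈ Y1, ∀ vh ∈ V1,
      F n (ystar n) vh ≤ F n (ystar n) (vstar n) ∧
      F n (ystar n) (vstar n) ≤ F n yh (vstar n))
    (hbdd : ∃ C : ℝ, ∀ n, F n (ystar n) (vstar n) ≤ (C : EReal))
    (y0 : Y) (v0 : V) (hy0 : y0 ∈ Y0) (hv0 : v0 ∈ V0)
    (hyconv : Tendsto ystar atTop (𝓝 y0)) (hvconv : Tendsto vstar atTop (𝓝 v0))
    (hliminf : ∀ vh ∈ V0, ∃ vn : ℕ → V, (∀ n, vn n ∈ V1) ∧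
      Tendsto vn atTop (𝓝 vh) ∧
      ((Finf y0 vh : ℝ) : EReal) ≤ Filter.liminf (fun n => F n (ystar n) (vn n)) atTop)
    (hlimsup : ∀ yh ∈ Y0, ∃ yn : ℕ → Y, (∀ n, yn n ∈ Y1) ∧
      Tendsto yn atTop (𝓝 yh) ∧
      Filter.limsup (fun n => F n (yn n) (vstar n)) atTop ≤ ((Finf yh v0 : ℝ) : EReal)) :
    (∀ yh ∈ Y0, ∀ vh ∈ V0, Finf y0 vh ≤ Finf y0 v0 ∧ Finf y0 v0 ≤ Finf yh v0) ∧
    Tendsto (fun n => F n (ystar n) (vstar n)) atTop (𝓝 ((Finf y0 v0 : ℝ) : EReal)) := by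
  have A : ∀ vh ∈ V0, ((Finf y0 vh : ℝ) : EReal) ≤
      Filter.liminf (fun n => F n (ystar n) (vstar n)) atTop := by
    intro vh hvh
    obtain ⟨vn, hm, _, h⟩ := hliminf vh hvh
    exact h.trans (Filter.liminf_le_liminf
      (Eventually.of_forall fun n => (hsaddle n _ (hymem n) _ (hm n)).1))
  have B : ∀ yh ∈ Y0, Filter.limsup (fun n => F n (ystar n) (vstar n)) atTop ≤
      ((Finf yh v0 : ℝ) : EReal) := by
    intro yh hyh
    obtain ⟨yn, hm, _, h⟩ := hlimsup yh hyh
    exact (Filter.limsup_le_limsup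
      (Eventually.of_forall fun n => (hsaddle n _ (hm n) _ (hvmem n)).2)).trans h
  have C : Filter.liminf (fun n => F n (ystar n) (vstar n)) atTop ≤
      Filter.limsup (fun n => F n (ystar n) (vstar n)) atTop := Filter.liminf_le_limsup
  refine ⟨fun yh hyh vh hvh => ⟨?_, ?_⟩, ?_⟩
  · exact EReal.coe_le_coe_iff.1 (((A vh hvh).trans C).trans (B y0 hy0))
  · exact EReal.coe_le_coe_iff.1 (((A v0 hv0).trans C).trans (B yh hyh))
  · exact tendsto_of_le_liminf_of_limsup_le (A v0 hv0) (B y0 hy0)
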